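/- arXiv:math/0605277 — 2 statements merged into one kernel-verified Lean document; each statement's English description precedes it below -/
import Mathlib

section
/- For all vectors u, v in ℝ⁷, the 7-form identity (ι_u φ₀) ∧ (ι_v φ₀) ∧ φ₀ = 6⟨u,v⟩ e^{1234567} holds; that is, the G₂ 3-form φ₀ determines the Euclidean inner product via ⟨u,v⟩ = [(ι_u φ₀) ∧ (ι_v φ₀) ∧ φ₀] / (6 e^{1234567}). -/
open scoped RealInnerProductSpace

noncomputable section

/-- `V7` is ℝ⁷ with its Euclidean inner product. -/
abbrev V7 : Type := EuclideanSpace ℝ (Fin 7)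

/-- Evaluation of the wedge product `eⁱ ∧ eʲ ∧ eᵏ` of dual basis 1-forms on three vectors. -/
def w3 (i j k : Fin 7) (u v w : V7) : ℝ :=
  Matrix.det !![u i, u j, u k; v i, v j, v k; w i, w j, w k]

/-- Evaluation of the wedge product `eⁱ ∧ eʲ ∧ eᵏ ∧ eˡ` on four vectors. -/
def w4 (i j k l : Fin 7) (u v w z : V7) : ℝ :=
  Matrix.det !![u i, u j, u k, u l; v i, v j, v k, v l;
                w i, w j, w k, w l; z i, z j, z k, z l]

/-- The standard G₂ 3-form φ₀ = e¹²³+e¹⁴⁵+e¹⁶⁷+e²⁴⁶−e²⁵⁷−e³⁴⁷−e³⁵⁶ (0-indexed). -/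
def phi0 (u v w : V7) : ℝ :=
  w3 0 1 2 u v w + w3 0 3 4 u v w + w3 0 5 6 u v w + w3 1 3 5 u v w
    - w3 1 4 6 u v w - w3 2 3 6 u v w - w3 2 4 5 u v w

/-- The 4-form ψ₀ = ∗φ₀ = e⁴⁵⁶⁷+e²³⁶⁷+e²³⁴⁵+e¹³⁵⁷−e¹³⁴⁶−e¹²⁵⁶−e¹²⁴⁷ (0-indexed). -/
def psi0 (u v w z : V7) : ℝ :=
  w4 3 4 5 6 u v w z + w4 1 2 5 6 u v w z + w4 1 2 3 4 u v w z + w4 0 2 4 6 u v w z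
    - w4 0 2 3 5 u v w z - w4 0 1 4 5 u v w z - w4 0 1 3 6 u v w z

/-- The standard volume form e¹∧⋯∧e⁷ evaluated on seven vectors. -/
def vol7 (x : Fin 7 → V7) : ℝ := Matrix.det (Matrix.of fun i j => x i j)

/-- Evaluation of the wedge product of two 2-forms and a 3-form on seven vectors,
with the usual 1/(2!·2!·3!) normalization. -/
def wedge223 (A B : V7 → V7 → ℝ) (C : V7 → V7 → V7 → ℝ) (x : Fin 7 → V7) : ℝ :=
  (∑ σ : Equiv.Perm (Fin 7), ((Equiv.Perm.sign σ : ℤ) : ℝ) *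
      (A (x (σ 0)) (x (σ 1)) * B (x (σ 2)) (x (σ 3)) *
        C (x (σ 4)) (x (σ 5)) (x (σ 6)))) / 24

/-- First index of the `r`-th term of `ι_{e_p} φ₀`. -/
def g2i : Fin 7 → Fin 3 → Fin 7 :=
  ![![1, 3, 5], ![2, 3, 4], ![0, 3, 4], ![4, 5, 6], ![0, 6, 5], ![6, 1, 2], ![0, 1, 2]]

/-- Second index of the `r`-th term of `ι_{e_p} φ₀`. -/
def g2j : Fin 7 → Fin 3 → Fin 7 :=
  ![![2, 4, 6], ![0, 5, 6], ![1, 6, 5], ![0, 1, 2], ![3, 1, 2], ![0, 3, 4], ![5, 4, 3]]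

/-- Sign of the `r`-th term of `ι_{e_p} φ₀`. -/
def g2s : Fin 7 → Fin 3 → ℤ :=
  ![![1, 1, 1], ![1, 1, -1], ![1, -1, -1], ![1, 1, -1], ![1, -1, -1], ![1, 1, -1], ![1, -1, -1]]

/-- Indices of the seven terms of `φ₀`. -/
def g2t : Fin 7 → Fin 3 → Fin 7 :=
  ![![0, 1, 2], ![0, 3, 4], ![0, 5, 6], ![1, 3, 5], ![1, 4, 6], ![2, 3, 6], ![2, 4, 5]]

/-- Signs of the seven terms of `φ₀`. -/
def g2e : Fin 7 → ℤ := ![1, 1, 1, 1, -1, -1, -1]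

/-- The elementary 2-form `eⁱ ∧ eʲ`. -/
def w2 (i j : Fin 7) (a b : V7) : ℝ := a i * b j - a j * b i

theorem phi0_eq2 (u a b : V7) :
    phi0 u a b = ∑ p, ∑ r, u p * ((g2s p r : ℤ) : ℝ) * w2 (g2i p r) (g2j p r) a b := by
  simp [phi0, w3, w2, Fin.sum_univ_succ, g2s, g2i, g2j, Matrix.det_fin_three]
  ring

theorem phi0_eq3 (a b c : V7) :
    phi0 a b c = ∑ t, ((g2e t : ℤ) : ℝ) * w3 (g2t t 0) (g2t t 1) (g2t t 2) a b c := by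
  simp [phi0, Fin.sum_univ_succ, g2e, g2t]
  ring

/-- Minor with columns chosen by `f`. -/
def colDet (x : Fin 7 → V7) (f : Fin 7 → Fin 7) : ℝ := Matrix.det (Matrix.of fun i j => x i (f j))

/-- Vandermonde product, written out. -/
def vdx (a b c d e f g : ℤ) : ℤ :=
  ((b - a) * (c - a) * (d - a) * (e - a) * (f - a) * (g - a)) *
  ((c - b) * (d - b) * (e - b) * (f - b) * (g - b)) *
  ((d - c) * (e - c) * (f - c) * (g - c)) *
  ((e - d) * (f - d) * (g - d)) *
  ((f - e) * (g - e)) *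
  ((g - f))

/-- Vandermonde product. -/
def vdm (f : Fin 7 → Fin 7) : ℤ :=
  vdx (f 0 : ℕ) (f 1 : ℕ) (f 2 : ℕ) (f 3 : ℕ) (f 4 : ℕ) (f 5 : ℕ) (f 6 : ℕ)

theorem vdm_eq (f : Fin 7 → Fin 7) :
    vdm f = ∏ i, ∏ j ∈ Finset.Ioi i, (((f j : ℕ) : ℤ) - ((f i : ℕ) : ℤ)) := by
  have h0 : Finset.Ioi (0 : Fin 7) = {1, 2, 3, 4, 5, 6} := by decide
  have h1 : Finset.Ioi (1 : Fin 7) = {2, 3, 4, 5, 6} := by decide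
  have h2 : Finset.Ioi (2 : Fin 7) = {3, 4, 5, 6} := by decide
  have h3 : Finset.Ioi (3 : Fin 7) = {4, 5, 6} := by decide
  have h4 : Finset.Ioi (4 : Fin 7) = {5, 6} := by decide
  have h5 : Finset.Ioi (5 : Fin 7) = {6} := by decide
  have h6 : Finset.Ioi (6 : Fin 7) = ∅ := by decide
  rw [Fin.prod_univ_seven, h0, h1, h2, h3, h4, h5, h6]
  simp [vdm, vdx, Finset.prod_insert, mul_assoc]

theorem vdm_id : vdm id = 24883200 := by simp [vdm, vdx]

theorem colDet_eq (x : Fin 7 → V7) (f : Fin 7 → Fin 7) :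
    colDet x f * 24883200 = (vdm f : ℝ) * vol7 x := by
  let P : Matrix (Fin 7) (Fin 7) ℝ := Matrix.of fun k j => if k = f j then 1 else 0
  have h1 : colDet x f = vol7 x * P.det := by
    rw [colDet, vol7, ← Matrix.det_mul]
    congr 1
    ext i j
    simp [P, Matrix.mul_apply]
  have hv (g : Fin 7 → Fin 7) :
      (Matrix.vandermonde (fun i => (((g i : ℕ) : ℝ)))).transpose.det = (vdm g : ℝ) := by
    rw [Matrix.det_transpose, Matrix.det_vandermonde, vdm_eq]
    push_cast
    rfl
  have h2 : (vdm f : ℝ) = (vdm id : ℝ) * P.det := by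
    rw [← hv, ← hv, ← Matrix.det_mul]
    congr 1
    ext i j
    simp [P, Matrix.mul_apply, Matrix.vandermonde_apply]
  rw [h1, h2, vdm_id]
  push_cast
  ring

theorem colDet_sum (x : Fin 7 → V7) (f : Fin 7 → Fin 7) :
    ∑ σ : Equiv.Perm (Fin 7), ((Equiv.Perm.sign σ : ℤ) : ℝ) *
      (x (σ 0) (f 0) * x (σ 1) (f 1) * x (σ 2) (f 2) * x (σ 3) (f 3) * x (σ 4) (f 4) *
        x (σ 5) (f 5) * x (σ 6) (f 6)) = colDet x f := by
  rw [colDet, Matrix.det_apply']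
  simp [Fin.prod_univ_seven]

theorem colDet_swap (x : Fin 7 → V7) (f : Fin 7 → Fin 7) (a b : Fin 7) (h : a ≠ b) :
    colDet x (f ∘ Equiv.swap a b) = - colDet x f := by
  have := Matrix.det_permute' (Equiv.swap a b) (Matrix.of fun i j => x i (f j))
  rw [Equiv.Perm.sign_swap h] at this
  simpa [colDet, Matrix.submatrix] using this

theorem wedge_elem (x : Fin 7 → V7) (i j k l m n o : Fin 7) :
    ∑ σ : Equiv.Perm (Fin 7), ((Equiv.Perm.sign σ : ℤ) : ℝ) *
      (w2 i j (x (σ 0)) (x (σ 1)) * w2 k l (x (σ 2)) (x (σ 3)) *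
        w3 m n o (x (σ 4)) (x (σ 5)) (x (σ 6))) = 24 * colDet x ![i, j, k, l, m, n, o] := by
  have s1 (i j k l m n o : Fin 7) :
      colDet x ![j, i, k, l, m, n, o] = - colDet x ![i, j, k, l, m, n, o] := by
    rw [← colDet_swap x _ 0 1 (by decide)]
    congr 1; ext t; fin_cases t <;> rfl
  have s2 (i j k l m n o : Fin 7) :
      colDet x ![i, j, l, k, m, n, o] = - colDet x ![i, j, k, l, m, n, o] := by
    rw [← colDet_swap x _ 2 3 (by decide)]
    congr 1; ext t; fin_cases t <;> rfl
  have s3 (i j k l m n o : Fin 7) :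
      colDet x ![i, j, k, l, n, m, o] = - colDet x ![i, j, k, l, m, n, o] := by
    rw [← colDet_swap x _ 4 5 (by decide)]
    congr 1; ext t; fin_cases t <;> rfl
  have s4 (i j k l m n o : Fin 7) :
      colDet x ![i, j, k, l, m, o, n] = - colDet x ![i, j, k, l, m, n, o] := by
    rw [← colDet_swap x _ 5 6 (by decide)]
    congr 1; ext t; fin_cases t <;> rfl
  -- the 3-form part, for fixed first four columns
  have key (i j k l : Fin 7) :
      ∑ σ : Equiv.Perm (Fin 7), ((Equiv.Perm.sign σ : ℤ) : ℝ) *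
        (x (σ 0) i * x (σ 1) j * x (σ 2) k * x (σ 3) l *
          w3 m n o (x (σ 4)) (x (σ 5)) (x (σ 6))) = 6 * colDet x ![i, j, k, l, m, n, o] := by
    have e1 := colDet_sum x ![i, j, k, l, m, n, o]
    have e2 := colDet_sum x ![i, j, k, l, m, o, n]
    have e3 := colDet_sum x ![i, j, k, l, n, m, o]
    have e4 := colDet_sum x ![i, j, k, l, n, o, m]
    have e5 := colDet_sum x ![i, j, k, l, o, m, n]
    have e6 := colDet_sum x ![i, j, k, l, o, n, m]
    have r2 := s4 i j k l m n o
    have r3 := s3 i j k l m n o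
    have r4 := s4 i j k l n m o
    have r5 := s3 i j k l m o n
    have r6 := s3 i j k l n o m
    have : 6 * colDet x ![i, j, k, l, m, n, o] =
        colDet x ![i, j, k, l, m, n, o] - colDet x ![i, j, k, l, m, o, n]
        - colDet x ![i, j, k, l, n, m, o] + colDet x ![i, j, k, l, n, o, m]
        + colDet x ![i, j, k, l, o, m, n] - colDet x ![i, j, k, l, o, n, m] := by linarith
    rw [this, ← e1, ← e2, ← e3, ← e4, ← e5, ← e6]
    simp only [← Finset.sum_sub_distrib, ← Finset.sum_add_distrib]
    refine Finset.sum_congr rfl fun σ _ => ?_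
    simp [w3, Matrix.det_fin_three]
    ring
  have : 24 * colDet x ![i, j, k, l, m, n, o] =
      6 * colDet x ![i, j, k, l, m, n, o] - 6 * colDet x ![j, i, k, l, m, n, o]
      - 6 * colDet x ![i, j, l, k, m, n, o] + 6 * colDet x ![j, i, l, k, m, n, o] := by
    rw [s1 i j, s1 i j, s2 i j k l]
    ring
  rw [this, ← key, ← key, ← key, ← key]
  simp only [← Finset.sum_sub_distrib, ← Finset.sum_add_distrib]
  refine Finset.sum_congr rfl fun σ _ => ?_
  simp only [w2]
  ring

/-- The integer coefficient of `u p * v q`. -/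
def g2M (p q : Fin 7) : ℤ := ∑ r, ∑ r', ∑ t, g2s p r * g2s q r' * g2e t *
  vdm ![g2i p r, g2j p r, g2i q r', g2j q r', g2t t 0, g2t t 1, g2t t 2]

/-- Base 8 digit extraction; it makes table lookups cheap in the kernel. -/
def dig (N k : ℕ) : ℕ := Nat.land (Nat.shiftRight N (Nat.mul 3 k)) 7

/-- The index tables in base 8. -/
def ci (k : ℕ) : ℤ := Int.ofNat (dig 2454979724412335449 k)

/-- The index tables in base 8. -/
def cj (k : ℕ) : ℤ := Int.ofNat (dig 4135158453214073250 k)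

/-- The index tables in base 8. -/
def ct (k : ℕ) : ℤ := Int.ofNat (dig 6391551367351251080 k)

/-- The sign tables in base 8. -/
def cs (k : ℕ) : ℤ := Int.subNatNat 1 (dig 2598586897815109632 k)

/-- The sign tables in base 8. -/
def ce (k : ℕ) : ℤ := Int.subNatNat 1 (dig 598016 k)

theorem ci_eq : ∀ p r, ((g2i p r : ℕ) : ℤ) = ci (3 * p.val + r.val) := by decide +kernel

theorem cj_eq : ∀ p r, ((g2j p r : ℕ) : ℤ) = cj (3 * p.val + r.val) := by decide +kernel

theorem ct_eq : ∀ p r, ((g2t p r : ℕ) : ℤ) = ct (3 * p.val + r.val) := by decide +kernel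

theorem cs_eq : ∀ p r, g2s p r = cs (3 * p.val + r.val) := by decide +kernel

theorem ce_eq : ∀ t, g2e t = ce t.val := by decide +kernel

/-- One term of `g2M`, with encoded indices. -/
def cterm (k k' t : ℕ) : ℤ := cs k * cs k' * ce t *
  vdx (ci k) (cj k) (ci k') (cj k') (ct (3 * t)) (ct (3 * t + 1)) (ct (3 * t + 2))

/-- Sum over the seven terms of `φ₀`. -/
def csum (k k' : ℕ) : ℤ := cterm k k' 0 + cterm k k' 1 + cterm k k' 2 + cterm k k' 3 +
  cterm k k' 4 + cterm k k' 5 + cterm k k' 6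

theorem g2M_code (p q : Fin 7) :
    g2M p q = ∑ r : Fin 3, ∑ r' : Fin 3, csum (3 * p.val + r.val) (3 * q.val + r'.val) := by
  have h (p q : Fin 7) (r r' : Fin 3) (t : Fin 7) : g2s p r * g2s q r' * g2e t *
      vdm ![g2i p r, g2j p r, g2i q r', g2j q r', g2t t 0, g2t t 1, g2t t 2] =
      cterm (3 * p.val + r.val) (3 * q.val + r'.val) t.val := by
    rw [cs_eq, cs_eq, ce_eq]
    change _ * vdx (g2i p r : ℕ) (g2j p r : ℕ) (g2i q r' : ℕ) (g2j q r' : ℕ) (g2t t 0 : ℕ)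
      (g2t t 1 : ℕ) (g2t t 2 : ℕ) = _
    rw [ci_eq, ci_eq, cj_eq, cj_eq, ct_eq, ct_eq, ct_eq]
    rfl
  simp only [g2M, h]
  refine Finset.sum_congr rfl fun r _ => Finset.sum_congr rfl fun r' _ => ?_
  rw [Fin.sum_univ_seven]
  rfl

/-- Encoded form of `g2M`. -/
def cM (p q : ℕ) : ℤ :=
  csum (3 * p) (3 * q) + csum (3 * p) (3 * q + 1) + csum (3 * p) (3 * q + 2) +
  (csum (3 * p + 1) (3 * q) + csum (3 * p + 1) (3 * q + 1) + csum (3 * p + 1) (3 * q + 2)) +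
  (csum (3 * p + 2) (3 * q) + csum (3 * p + 2) (3 * q + 1) + csum (3 * p + 2) (3 * q + 2))

theorem cM_eq : ∀ p q : Fin 7, cM p.val q.val = if p = q then 6 * 24883200 else 0 := by
  decide +kernel

theorem g2M_eq (p q : Fin 7) : g2M p q = if p = q then 6 * 24883200 else 0 := by
  rw [g2M_code, ← cM_eq]
  simp only [Fin.sum_univ_three]
  rfl

/-- The 7-form identity (ι_u φ₀) ∧ (ι_v φ₀) ∧ φ₀ = 6⟨u,v⟩ e¹²³⁴⁵⁶⁷: the G₂ 3-form
determines the Euclidean inner product. -/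
theorem interior_product_wedge_identity (u v : V7) (x : Fin 7 → V7) :
    wedge223 (fun a b => phi0 u a b) (fun a b => phi0 v a b) phi0 x =
      6 * (⟪u, v⟫ : ℝ) * vol7 x := by
  have h : wedge223 (fun a b => phi0 u a b) (fun a b => phi0 v a b) phi0 x =
      ∑ p, ∑ q, ∑ r, ∑ r', ∑ t, u p * v q * (g2s p r * g2s q r' * g2e t : ℤ) *
        colDet x ![g2i p r, g2j p r, g2i q r', g2j q r', g2t t 0, g2t t 1, g2t t 2] := by
    have h24 (f : Fin 7 → Fin 7) : colDet x f = (24 * colDet x f) / 24 := by ring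
    simp only [wedge223]
    rw [div_eq_iff (by norm_num)]
    simp only [Finset.sum_mul]
    have e : ∀ p q r r' t, u p * v q * (g2s p r * g2s q r' * g2e t : ℤ) *
        colDet x ![g2i p r, g2j p r, g2i q r', g2j q r', g2t t 0, g2t t 1, g2t t 2] * 24 =
        ∑ σ : Equiv.Perm (Fin 7), u p * v q * (g2s p r * g2s q r' * g2e t : ℤ) *
        (((Equiv.Perm.sign σ : ℤ) : ℝ) *
          (w2 (g2i p r) (g2j p r) (x (σ 0)) (x (σ 1)) *
           w2 (g2i q r') (g2j q r') (x (σ 2)) (x (σ 3)) *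
           w3 (g2t t 0) (g2t t 1) (g2t t 2) (x (σ 4)) (x (σ 5)) (x (σ 6)))) := by
      intro p q r r' t
      rw [← Finset.mul_sum, wedge_elem]
      ring
    simp only [e]
    simp only [Finset.sum_comm (s := (Finset.univ : Finset (Fin 3)))
      (t := (Finset.univ : Finset (Equiv.Perm (Fin 7)))),
      Finset.sum_comm (s := (Finset.univ : Finset (Fin 7)))
      (t := (Finset.univ : Finset (Equiv.Perm (Fin 7))))]
    refine Finset.sum_congr rfl fun σ _ => ?_
    rw [phi0_eq2 u, phi0_eq2 v, phi0_eq3, Finset.sum_mul_sum, Finset.sum_mul, Finset.mul_sum]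
    refine Finset.sum_congr rfl fun p _ => ?_
    rw [Finset.sum_mul, Finset.mul_sum]
    refine Finset.sum_congr rfl fun q _ => ?_
    rw [Finset.sum_mul_sum, Finset.sum_mul, Finset.mul_sum]
    refine Finset.sum_congr rfl fun r _ => ?_
    rw [Finset.sum_mul, Finset.mul_sum]
    refine Finset.sum_congr rfl fun r' _ => ?_
    rw [Finset.mul_sum, Finset.mul_sum]
    refine Finset.sum_congr rfl fun t _ => ?_
    push_cast
    ring
  have h2 : wedge223 (fun a b => phi0 u a b) (fun a b => phi0 v a b) phi0 x * 24883200 =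
      ∑ p, ∑ q, u p * v q * (g2M p q : ℝ) * vol7 x := by
    rw [h]
    simp only [Finset.sum_mul, g2M, mul_assoc, colDet_eq]
    refine Finset.sum_congr rfl fun p _ => Finset.sum_congr rfl fun q _ => ?_
    push_cast
    simp only [Finset.sum_mul, Finset.mul_sum]
    refine Finset.sum_congr rfl fun r _ => Finset.sum_congr rfl fun r' _ =>
      Finset.sum_congr rfl fun t _ => ?_
    ring
  have h3 : (⟪u, v⟫ : ℝ) = ∑ p, u p * v p := by
    rw [PiLp.inner_apply]
    refine Finset.sum_congr rfl fun p _ => ?_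
    simp [mul_comm]
  have h4 : ∑ p, ∑ q, u p * v q * (g2M p q : ℝ) * vol7 x =
      6 * (∑ p, u p * v p) * vol7 x * 24883200 := by
    simp only [g2M_eq, Finset.mul_sum, Finset.sum_mul]
    refine Finset.sum_congr rfl fun p _ => ?_
    rw [Finset.sum_eq_single p]
    · simp only [if_true]
      push_cast
      ring
    · intro q _ hq
      simp [hq.symm]
    · simp
  rw [h3]
  have := h2.trans h4
  linarith
end
end

section
/- For every vector ξ in ℝ⁷, the 6-form identity (ι_ξ φ₀) ∧ (ι_ξ φ₀) ∧ (ι_ξ φ₀) = 6‖ξ‖² ι_ξ(e^{1234567}) holds. In particular, for ξ ≠ 0 the 2-form ω_ξ = ι_ξ φ₀ is nondegenerate on the 6-plane ξ⊥: for every nonzero u orthogonal to ξ there exists v orthogonal to ξ with φ₀(ξ,u,v) ≠ 0. -/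
open scoped RealInnerProductSpace

noncomputable section

/-- Evaluation of the wedge of three 2-forms on six vectors, normalized by 1/(2!·2!·2!). -/
def wedge222 (A B C : V7 → V7 → ℝ) (x : Fin 6 → V7) : ℝ :=
  (∑ σ : Equiv.Perm (Fin 6), ((Equiv.Perm.sign σ : ℤ) : ℝ) *
      (A (x (σ 0)) (x (σ 1)) * B (x (σ 2)) (x (σ 3)) * C (x (σ 4)) (x (σ 5)))) / 8

/-- Coordinate expansion of `phi0`. -/
theorem phi0_expand (a u v : V7) : phi0 a u v =
    (a 1 * u 2 - a 2 * u 1 + a 3 * u 4 - a 4 * u 3 + a 5 * u 6 - a 6 * u 5) * v 0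
  + (a 2 * u 0 - a 0 * u 2 + a 3 * u 5 - a 5 * u 3 - (a 4 * u 6 - a 6 * u 4)) * v 1
  + (a 0 * u 1 - a 1 * u 0 - (a 3 * u 6 - a 6 * u 3) - (a 4 * u 5 - a 5 * u 4)) * v 2
  + (a 4 * u 0 - a 0 * u 4 + a 5 * u 1 - a 1 * u 5 - (a 6 * u 2 - a 2 * u 6)) * v 3
  + (a 0 * u 3 - a 3 * u 0 - (a 6 * u 1 - a 1 * u 6) - (a 5 * u 2 - a 2 * u 5)) * v 4
  + (a 6 * u 0 - a 0 * u 6 + a 1 * u 3 - a 3 * u 1 - (a 2 * u 4 - a 4 * u 2)) * v 5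
  + (a 0 * u 5 - a 5 * u 0 - (a 1 * u 4 - a 4 * u 1) - (a 2 * u 3 - a 3 * u 2)) * v 6 := by
  simp only [phi0, w3, Matrix.det_fin_three, Matrix.of_apply, Matrix.cons_val', Matrix.cons_val_zero,
    Matrix.cons_val_one, Matrix.cons_val, Matrix.cons_val_fin_one]
  ring

/-- The bilinear form `ι_ξ φ₀`. -/
def omegaB (ξ : V7) : V7 →ₗ[ℝ] V7 →ₗ[ℝ] ℝ :=
  LinearMap.mk₂ ℝ (fun u v => phi0 ξ u v)
    (by intros; simp only [phi0_expand, PiLp.add_apply]; ring)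
    (by intros; simp only [phi0_expand, PiLp.smul_apply, smul_eq_mul]; ring)
    (by intros; simp only [phi0_expand, PiLp.add_apply]; ring)
    (by intros; simp only [phi0_expand, PiLp.smul_apply, smul_eq_mul]; ring)

theorem omegaB_apply (ξ u v : V7) : omegaB ξ u v = phi0 ξ u v := rfl

/-- The signed sum over permutations. -/
def altsum {α : Type} (n : ℕ) (f : (Fin n → α) → ℝ) (x : Fin n → α) : ℝ :=
  ∑ σ : Equiv.Perm (Fin n), ((Equiv.Perm.sign σ : ℤ) : ℝ) * f (fun i => x (σ i))

theorem altsum_succ {α : Type} (n : ℕ) (f : (Fin (n + 1) → α) → ℝ) (x : Fin (n + 1) → α) :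
    altsum (n + 1) f x = ∑ p : Fin (n + 1), (if p = 0 then 1 else -1) *
      altsum n (fun y => f (Fin.cons (x p) y)) (fun i => x (Equiv.swap 0 p i.succ)) := by
  unfold altsum
  rw [← Equiv.sum_comp Equiv.Perm.decomposeFin.symm, Fintype.sum_prod_type]
  refine Finset.sum_congr rfl fun p _ => ?_
  rw [Finset.mul_sum]
  refine Finset.sum_congr rfl fun e _ => ?_
  rw [Equiv.Perm.decomposeFin.symm_sign]
  have : (fun i => x (Equiv.Perm.decomposeFin.symm (p, e) i))
      = Fin.cons (x p) (fun i => x (Equiv.swap 0 p (e i).succ)) := by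
    funext i
    refine Fin.cases ?_ (fun i => ?_) i
    · simp
    · simp [Equiv.Perm.decomposeFin_symm_apply_succ]
  rw [this]
  split_ifs <;> simp

theorem altsum_zero {α : Type} (f : (Fin 0 → α) → ℝ) (x : Fin 0 → α) :
    altsum 0 f x = f x := by
  simp [altsum]

theorem altsum_two {α : Type} (A : α → α → ℝ) (hA : ∀ a b, A b a = - A a b) (c : ℝ)
    (x : Fin 2 → α) : altsum 2 (fun y => c * A (y 0) (y 1)) x = 2 * c * A (x 0) (x 1) := by
  simp [altsum_succ, altsum_zero, Fin.sum_univ_succ]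
  rw [hA (x 0) (x 1)]; ring

theorem altsum_step2 {α : Type} (n : ℕ) (f : (Fin (n + 2) → α) → ℝ) (x : Fin (n + 2) → α) :
    altsum (n + 2) f x = ∑ p : Fin (n + 2), ∑ q : Fin (n + 1),
      (if p = 0 then 1 else -1) * ((if q = 0 then 1 else -1) *
      altsum n (fun y => f (Fin.cons (x p) (Fin.cons (x (Equiv.swap 0 p q.succ)) y : Fin (n + 1) → α)))
        (fun i => x (Equiv.swap 0 p (Equiv.swap 0 q i.succ).succ))) := by
  rw [altsum_succ]
  simp only [altsum_succ n, Finset.mul_sum]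

/-- The index reached by removing `p` and then `q`. -/
def idx (n : ℕ) (p : Fin (n + 2)) (q : Fin (n + 1)) (i : Fin n) : Fin (n + 2) :=
  Equiv.swap 0 p (Equiv.swap 0 q i.succ).succ

/-- The second removed index. -/
def idq (n : ℕ) (p : Fin (n + 2)) (q : Fin (n + 1)) : Fin (n + 2) := Equiv.swap 0 p q.succ

theorem altsum_four {α : Type} (A : α → α → ℝ) (hA : ∀ a b, A b a = - A a b) (c : ℝ)
    (x : Fin 4 → α) : altsum 4 (fun y => c * A (y 0) (y 1) * A (y 2) (y 3)) x =
      8 * c * (A (x 0) (x 1) * A (x 2) (x 3) - A (x 0) (x 2) * A (x 1) (x 3)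
        + A (x 0) (x 3) * A (x 1) (x 2)) := by
  have h : altsum 4 (fun y => c * A (y 0) (y 1) * A (y 2) (y 3)) x =
      ∑ p : Fin 4, ∑ q : Fin 3, (if p = 0 then 1 else -1) * ((if q = 0 then 1 else -1) *
        (2 * (c * A (x p) (x (idq 2 p q))) * A (x (idx 2 p q 0)) (x (idx 2 p q 1)))) := by
    rw [altsum_step2 2]
    refine Finset.sum_congr rfl fun p _ => Finset.sum_congr rfl fun q _ => ?_
    congr 2
    exact altsum_two A hA (c * A (x p) (x (idq 2 p q))) (idx 2 p q · |> x)
  rw [h]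
  simp only [Fin.sum_univ_four, Fin.sum_univ_three, idx, idq, Equiv.swap_apply_def]
  simp +decide
  rw [hA (x 0) (x 1), hA (x 0) (x 2), hA (x 0) (x 3), hA (x 1) (x 2), hA (x 1) (x 3),
    hA (x 2) (x 3)]
  ring

theorem altsum_six {α : Type} (A : α → α → ℝ) (hA : ∀ a b, A b a = - A a b)
    (x : Fin 6 → α) : altsum 6 (fun y => A (y 0) (y 1) * A (y 2) (y 3) * A (y 4) (y 5)) x =
      48 * (A (x 0) (x 1) * (A (x 2) (x 3) * A (x 4) (x 5) - A (x 2) (x 4) * A (x 3) (x 5)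
              + A (x 2) (x 5) * A (x 3) (x 4))
          - A (x 0) (x 2) * (A (x 1) (x 3) * A (x 4) (x 5) - A (x 1) (x 4) * A (x 3) (x 5)
              + A (x 1) (x 5) * A (x 3) (x 4))
          + A (x 0) (x 3) * (A (x 1) (x 2) * A (x 4) (x 5) - A (x 1) (x 4) * A (x 2) (x 5)
              + A (x 1) (x 5) * A (x 2) (x 4))
          - A (x 0) (x 4) * (A (x 1) (x 2) * A (x 3) (x 5) - A (x 1) (x 3) * A (x 2) (x 5)
              + A (x 1) (x 5) * A (x 2) (x 3))
          + A (x 0) (x 5) * (A (x 1) (x 2) * A (x 3) (x 4) - A (x 1) (x 3) * A (x 2) (x 4)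
              + A (x 1) (x 4) * A (x 2) (x 3))) := by
  have h : altsum 6 (fun y => A (y 0) (y 1) * A (y 2) (y 3) * A (y 4) (y 5)) x =
      ∑ p : Fin 6, ∑ q : Fin 5, (if p = 0 then 1 else -1) * ((if q = 0 then 1 else -1) *
        (8 * A (x p) (x (idq 4 p q)) *
          (A (x (idx 4 p q 0)) (x (idx 4 p q 1)) * A (x (idx 4 p q 2)) (x (idx 4 p q 3))
            - A (x (idx 4 p q 0)) (x (idx 4 p q 2)) * A (x (idx 4 p q 1)) (x (idx 4 p q 3))
            + A (x (idx 4 p q 0)) (x (idx 4 p q 3)) * A (x (idx 4 p q 1)) (x (idx 4 p q 2))))) := by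
    rw [altsum_step2 4]
    refine Finset.sum_congr rfl fun p _ => Finset.sum_congr rfl fun q _ => ?_
    congr 2
    exact altsum_four A hA (A (x p) (x (idq 4 p q))) (idx 4 p q · |> x)
  rw [h]
  simp only [Fin.sum_univ_six, Fin.sum_univ_five, idx, idq, Equiv.swap_apply_def]
  simp +decide
  simp only [hA (x 0) (x 1), hA (x 0) (x 2), hA (x 0) (x 3), hA (x 0) (x 4), hA (x 0) (x 5),
    hA (x 1) (x 2), hA (x 1) (x 3), hA (x 1) (x 4), hA (x 1) (x 5),
    hA (x 2) (x 3), hA (x 2) (x 4), hA (x 2) (x 5), hA (x 3) (x 4), hA (x 3) (x 5),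
    hA (x 4) (x 5)]
  ring

theorem phi0_antisymm (ξ u v : V7) : phi0 ξ v u = - phi0 ξ u v := by
  simp only [phi0_expand]; ring

/-- `ω ⊗ ω ⊗ ω` as a multilinear map. -/
def omega3 (ξ : V7) : MultilinearMap ℝ (fun _ : Fin 6 => V7) ℝ where
  toFun x := omegaB ξ (x 0) (x 1) * omegaB ξ (x 2) (x 3) * omegaB ξ (x 4) (x 5)
  map_update_add' {inst} m i x y := by
    have : inst = instDecidableEqFin 6 := Subsingleton.elim _ _
    subst this
    fin_cases i <;> simp [Function.update] <;> ring
  map_update_smul' {inst} m i c x := by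
    have : inst = instDecidableEqFin 6 := Subsingleton.elim _ _
    subst this
    fin_cases i <;> simp [Function.update] <;> ring

/-- The left-hand side (times 8) as an alternating map. -/
def lhsForm (ξ : V7) : V7 [⋀^Fin 6]→ₗ[ℝ] ℝ := MultilinearMap.alternatization (omega3 ξ)

theorem lhsForm_apply (ξ : V7) (x : Fin 6 → V7) : lhsForm ξ x =
    altsum 6 (fun y => phi0 ξ (y 0) (y 1) * phi0 ξ (y 2) (y 3) * phi0 ξ (y 4) (y 5)) x := by
  simp only [lhsForm, MultilinearMap.alternatization_apply, altsum]
  refine Finset.sum_congr rfl fun σ _ => ?_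
  rw [Units.smul_def, zsmul_eq_mul]
  rfl

/-- The determinant of vectors in Euclidean space as an alternating map. -/
def volFormN (n : ℕ) : EuclideanSpace ℝ (Fin n) [⋀^Fin n]→ₗ[ℝ] ℝ :=
  (Matrix.detRowAlternating (n := Fin n) (R := ℝ)).compLinearMap
    (WithLp.linearEquiv 2 ℝ (Fin n → ℝ)).toLinearMap

theorem volFormN_apply (n : ℕ) (x : Fin n → EuclideanSpace ℝ (Fin n)) :
    volFormN n x = Matrix.det (Matrix.of fun i j => x i j) := rfl

/-- The volume form as an alternating map. -/
def volForm : V7 [⋀^Fin 7]→ₗ[ℝ] ℝ := volFormN 7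

theorem volForm_apply (x : Fin 7 → V7) : volForm x = vol7 x := by
  unfold volForm vol7
  exact volFormN_apply 7 x

/-- The right-hand side as an alternating map. -/
def rhsForm (ξ : V7) : V7 [⋀^Fin 6]→ₗ[ℝ] ℝ := volForm.curryLeft ξ

theorem rhsForm_apply (ξ : V7) (x : Fin 6 → V7) : rhsForm ξ x = vol7 (Fin.cons ξ x) := by
  rw [← volForm_apply, rhsForm, AlternatingMap.curryLeft_apply_apply, Matrix.vecCons]

/-- Standard basis vectors. -/
abbrev bv (i : Fin 7) : V7 := EuclideanSpace.single i (1 : ℝ)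

theorem vol7_basis (ξ : V7) (k : Fin 7) :
    vol7 (Fin.cons ξ fun i => bv (k.succAbove i)) = (-1) ^ (k : ℕ) * ξ k := by
  unfold vol7
  rw [Matrix.det_succ_row_zero, Finset.sum_eq_single k]
  · have : (Matrix.of fun i j => (Fin.cons ξ (fun i => bv (k.succAbove i)) : Fin 7 → V7) i j).submatrix
        Fin.succ k.succAbove = 1 := by
      ext i l
      simp [Matrix.one_apply, eq_comm]
    rw [this]
    simp
  · intro j _ hj
    obtain ⟨i, hi⟩ := Fin.exists_succAbove_eq hj
    rw [Matrix.det_eq_zero_of_row_eq_zero i, mul_zero]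
    intro l
    simp [hi, Fin.succAbove_ne]
  · simp

theorem forms_basis (ξ : V7) (k : Fin 7) :
    lhsForm ξ (fun i => bv (k.succAbove i)) =
      (48 * ‖ξ‖ ^ 2) * rhsForm ξ (fun i => bv (k.succAbove i)) := by
  rw [rhsForm_apply, vol7_basis, lhsForm_apply, altsum_six _ (phi0_antisymm ξ),
    EuclideanSpace.real_norm_sq_eq]
  simp only [phi0_expand, Fin.sum_univ_seven]
  fin_cases k <;> simp [Fin.succAbove, Fin.lt_def] <;> ring

theorem forms_eq (ξ : V7) : lhsForm ξ = (48 * ‖ξ‖ ^ 2) • rhsForm ξ := by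
  refine Module.Basis.ext_alternating (EuclideanSpace.basisFun (Fin 7) ℝ).toBasis fun v hv => ?_
  have hk : ∃ k, ∀ i, v i ≠ k := by
    by_contra! h
    have := Fintype.card_le_of_surjective v h
    simp at this
  obtain ⟨k, hk⟩ := hk
  choose σ hσ using fun i => Fin.exists_succAbove_eq (hk i)
  have hinj : Function.Injective σ := fun a b hab => hv (by rw [← hσ a, ← hσ b, hab])
  let τ : Equiv.Perm (Fin 6) := Equiv.ofBijective σ (Finite.injective_iff_bijective.mp hinj)
  have e : (fun i => (EuclideanSpace.basisFun (Fin 7) ℝ).toBasis (v i))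
      = (fun i => bv (k.succAbove i)) ∘ τ := by
    funext i
    simp [τ, hσ]
  rw [e, AlternatingMap.map_perm, AlternatingMap.map_perm, AlternatingMap.smul_apply,
    forms_basis, smul_eq_mul]

/-- The cross product determined by `phi0`. -/
def crossp (a u : V7) : V7 := WithLp.toLp 2
  ![a 1 * u 2 - a 2 * u 1 + a 3 * u 4 - a 4 * u 3 + a 5 * u 6 - a 6 * u 5,
    a 2 * u 0 - a 0 * u 2 + a 3 * u 5 - a 5 * u 3 - (a 4 * u 6 - a 6 * u 4),
    a 0 * u 1 - a 1 * u 0 - (a 3 * u 6 - a 6 * u 3) - (a 4 * u 5 - a 5 * u 4),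
    a 4 * u 0 - a 0 * u 4 + a 5 * u 1 - a 1 * u 5 - (a 6 * u 2 - a 2 * u 6),
    a 0 * u 3 - a 3 * u 0 - (a 6 * u 1 - a 1 * u 6) - (a 5 * u 2 - a 2 * u 5),
    a 6 * u 0 - a 0 * u 6 + a 1 * u 3 - a 3 * u 1 - (a 2 * u 4 - a 4 * u 2),
    a 0 * u 5 - a 5 * u 0 - (a 1 * u 4 - a 4 * u 1) - (a 2 * u 3 - a 3 * u 2)]

theorem inner_expand (u v : V7) : ⟪u, v⟫ = u 0 * v 0 + u 1 * v 1 + u 2 * v 2 + u 3 * v 3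
    + u 4 * v 4 + u 5 * v 5 + u 6 * v 6 := by
  simp [PiLp.inner_apply, Fin.sum_univ_seven, mul_comm]

theorem crossp_orth (a u : V7) : ⟪crossp a u, a⟫ = (0 : ℝ) := by
  rw [inner_expand]
  simp [crossp]
  ring

theorem phi0_crossp (a u : V7) :
    phi0 a u (crossp a u) = ‖a‖ ^ 2 * ‖u‖ ^ 2 - ⟪u, a⟫ ^ 2 := by
  rw [phi0_expand, inner_expand, EuclideanSpace.real_norm_sq_eq, EuclideanSpace.real_norm_sq_eq]
  simp only [Fin.sum_univ_seven]
  simp [crossp]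
  ring

/-- The 6-form identity ω_ξ∧ω_ξ∧ω_ξ = 6‖ξ‖² ι_ξ(e¹²³⁴⁵⁶⁷) for ω_ξ = ι_ξφ₀; in particular
for ξ ≠ 0 the 2-form ω_ξ is nondegenerate on the 6-plane ξ⊥. -/
theorem omega_cubed_and_nondegenerate :
    (∀ ξ : V7, ∀ x : Fin 6 → V7,
        wedge222 (fun a b => phi0 ξ a b) (fun a b => phi0 ξ a b) (fun a b => phi0 ξ a b) x =
          6 * ‖ξ‖ ^ 2 * vol7 (Fin.cons ξ x)) ∧
    (∀ ξ : V7, ξ ≠ 0 → ∀ u : V7, u ≠ 0 → ⟪u, ξ⟫ = (0 : ℝ) →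
        ∃ v : V7, ⟪v, ξ⟫ = (0 : ℝ) ∧ phi0 ξ u v ≠ 0) := by
  refine ⟨fun ξ x => ?_, fun ξ hξ u hu h => ⟨crossp ξ u, crossp_orth ξ u, ?_⟩⟩
  · have h := congrArg (fun F => F x) (forms_eq ξ)
    simp only [AlternatingMap.smul_apply, smul_eq_mul, rhsForm_apply, lhsForm_apply] at h
    have h2 : wedge222 (fun a b => phi0 ξ a b) (fun a b => phi0 ξ a b) (fun a b => phi0 ξ a b) x
      = altsum 6 (fun y => phi0 ξ (y 0) (y 1) * phi0 ξ (y 2) (y 3) * phi0 ξ (y 4) (y 5)) x / 8 := rfl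
    rw [h2, h]
    ring
  · rw [phi0_crossp, h]
    have h1 : 0 < ‖ξ‖ := norm_pos_iff.mpr hξ
    have h2 : 0 < ‖u‖ := norm_pos_iff.mpr hu
    have : 0 < ‖ξ‖ ^ 2 * ‖u‖ ^ 2 := by positivity
    simpa using this.ne'
end
end
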